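/- arXiv:2406.18467 — 3 statements merged into one kernel-verified Lean document; each statement's English description precedes it below -/
import Mathlib

section
/- (Swap preserves connectivity.) Let G = (V,E) be a connected finite simple graph, let (i,j) ∈ E, let h ∈ N(i) with h ≠ j, let f ∈ N(j) with f ≠ i, and suppose (i,f) ∉ E and (j,h) ∉ E. Then the graph G' with edge set (E \ {(i,h),(j,f)}) ∪ {(i,f),(j,h)} is connected. -/
/-- Swap preserves connectivity: removing edges (i,h),(j,f) and adding edges
(i,f),(j,h) keeps a connected graph connected. -/
theorem stmt_4 {V : Type*} [Fintype V] (G : SimpleGraph V)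
    (hconn : G.Connected) (i j h f : V)
    (hij : G.Adj i j) (hih : G.Adj i h) (hhj : h ≠ j)
    (hjf : G.Adj j f) (hfi : f ≠ i)
    (hif : ¬ G.Adj i f) (hjh : ¬ G.Adj j h) :
    (SimpleGraph.fromEdgeSet
      ((G.edgeSet \ {s(i, h), s(j, f)}) ∪ {s(i, f), s(j, h)})).Connected := by
  set H := SimpleGraph.fromEdgeSet
      ((G.edgeSet \ {s(i, h), s(j, f)}) ∪ {s(i, f), s(j, h)}) with hH
  have hne := hij.ne
  have a1 : H.Adj i j := by
    rw [hH, SimpleGraph.fromEdgeSet_adj]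
    refine ⟨Or.inl ⟨hij, ?_⟩, hne⟩
    simp only [Set.mem_insert_iff, Set.mem_singleton_iff, Sym2.eq_iff]
    grind
  have a2 : H.Adj i f := by
    rw [hH, SimpleGraph.fromEdgeSet_adj]
    exact ⟨Or.inr (Or.inl rfl), hfi.symm⟩
  have a3 : H.Adj j h := by
    rw [hH, SimpleGraph.fromEdgeSet_adj]
    exact ⟨Or.inr (Or.inr rfl), hhj.symm⟩
  have rih : H.Reachable i h := a1.reachable.trans a3.reachable
  have rjf : H.Reachable j f := a1.symm.reachable.trans a2.reachable
  have key : ∀ u v, G.Adj u v → H.Reachable u v := by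
    intro u v huv
    by_cases h1 : s(u, v) = s(i, h)
    · rcases Sym2.eq_iff.1 h1 with ⟨rfl, rfl⟩ | ⟨rfl, rfl⟩
      · exact rih
      · exact rih.symm
    by_cases h2 : s(u, v) = s(j, f)
    · rcases Sym2.eq_iff.1 h2 with ⟨rfl, rfl⟩ | ⟨rfl, rfl⟩
      · exact rjf
      · exact rjf.symm
    refine SimpleGraph.Adj.reachable ?_
    rw [hH, SimpleGraph.fromEdgeSet_adj]
    exact ⟨Or.inl ⟨huv, by simp only [Set.mem_insert_iff, Set.mem_singleton_iff]; tauto⟩, huv.ne⟩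
  have : Nonempty V := ⟨i⟩
  refine SimpleGraph.Connected.mk ?_
  intro u v
  obtain ⟨w⟩ := hconn.preconnected u v
  induction w with
  | nil => exact SimpleGraph.Reachable.refl _
  | cons hadj _ ih => exact (key _ _ hadj).trans ih
end

section
/- For every even natural number k ≥ 2 and every natural number n ≥ k + 1, there exists a connected k-regular simple graph on n vertices. -/
/-- For every even k ≥ 2 and every n ≥ k + 1 there exists a connected
k-regular simple graph on n vertices. -/
theorem stmt_11 (k n : ℕ) (hk : Even k) (hk2 : 2 ≤ k) (hn : k + 1 ≤ n) :
    ∃ G : SimpleGraph (Fin n), G.Connected ∧ ∀ v : Fin n, (G.neighborSet v).ncard = k := by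
  obtain ⟨m, rfl⟩ := hk
  obtain ⟨N, rfl⟩ : ∃ N, n = N + 1 := ⟨n - 1, by omega⟩
  let S : Set (Fin (N + 1)) := {x | (1 ≤ x.val ∧ x.val ≤ m) ∨ N + 1 - m ≤ x.val}
  have hneg : ∀ x : Fin (N + 1), x ∈ S → -x ∈ S := by
    intro x hx
    have hlt := x.isLt
    have h0 : x.val ≠ 0 := by
      rcases hx with h | h <;> omega
    have hv : (-x).val = N + 1 - x.val := by
      rw [Fin.val_neg']
      exact Nat.mod_eq_of_lt (by omega)
    change (1 ≤ (-x).val ∧ (-x).val ≤ m) ∨ N + 1 - m ≤ (-x).val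
    rw [hv]
    rcases hx with h | h <;> omega
  let G : SimpleGraph (Fin (N + 1)) :=
    { Adj := fun u v => v - u ∈ S
      symm := ⟨fun u v h => by
        have := hneg _ h
        rwa [neg_sub] at this⟩
      loopless := ⟨fun u h => by
        rw [sub_self] at h
        rcases h with h | h <;> simp at h
        omega⟩ }
  have hcard : S.ncard = m + m := by
    rw [← Set.ncard_image_of_injective S Fin.val_injective]
    have : Fin.val '' S = ((Finset.Icc 1 m ∪ Finset.Icc (N + 1 - m) N : Finset ℕ) : Set ℕ) := by
      ext y
      simp only [Set.mem_image, Finset.coe_union, Finset.coe_Icc, Set.mem_union, Set.mem_Icc]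
      constructor
      · rintro ⟨x, hx, rfl⟩
        have hlt := x.isLt
        rcases hx with h | h <;> omega
      · intro h
        refine ⟨⟨y, by omega⟩, ?_, rfl⟩
        change (1 ≤ y ∧ y ≤ m) ∨ N + 1 - m ≤ y
        omega
    rw [this, Set.ncard_coe_finset, Finset.card_union_of_disjoint]
    · simp only [Nat.card_Icc]
      omega
    · rw [Finset.disjoint_left]
      intro a
      simp only [Finset.mem_Icc]
      omega
  refine ⟨G, ?_, ?_⟩
  · have hr : ∀ v : Fin (N + 1), G.Reachable 0 v := by
      intro v
      induction v using Fin.induction with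
      | zero => exact SimpleGraph.Reachable.refl _
      | succ i ih =>
        refine ih.trans (SimpleGraph.Adj.reachable ?_)
        change i.succ - i.castSucc ∈ S
        have : i.succ - i.castSucc = 1 := by
          rw [← Fin.coeSucc_eq_succ, add_sub_cancel_left]
        rw [this]
        left
        have : (1 : Fin (N + 1)).val = 1 := by
          rw [Fin.val_one']
          exact Nat.mod_eq_of_lt (by omega)
        omega
    exact SimpleGraph.Connected.mk (fun u v => (hr u).symm.trans (hr v))
  · intro v
    have : G.neighborSet v = (fun x => x + v) '' S := by
      ext w
      simp only [Set.mem_image]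
      constructor
      · intro h
        exact ⟨w - v, h, by simp⟩
      · rintro ⟨x, hx, rfl⟩
        change x + v - v ∈ S
        simpa using hx
    rw [this, Set.ncard_image_of_injective S (add_left_injective v), hcard]
end

section
/- Let G be a connected finite simple graph and let k ∈ ℕ. Suppose the sets V_{>k} = {v : deg(v) > k} and V_{<k} = {v : deg(v) < k} are both nonempty, and let i ∈ V_{>k} and j ∈ V_{<k} be a pair achieving the minimum graph distance between V_{>k} and V_{<k}. Then every internal vertex of a shortest path between i and j has degree exactly k. -/
/-- If i has degree > k, j has degree < k, and the pair (i,j) achieves the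
minimum distance between the sets {deg > k} and {deg < k} in a connected graph,
then every internal vertex of a shortest path between i and j has degree k. -/
theorem stmt_12 {V : Type*} [Fintype V] (G : SimpleGraph V) [DecidableRel G.Adj]
    (hconn : G.Connected) (k : ℕ) (i j : V)
    (hi : k < G.degree i) (hj : G.degree j < k)
    (hmin : ∀ u v : V, k < G.degree u → G.degree v < k → G.dist i j ≤ G.dist u v)
    (p : G.Walk i j) (hp : p.IsPath) (hlen : p.length = G.dist i j) :
    ∀ v ∈ p.support, v ≠ i → v ≠ j → G.degree v = k := by
  classical
  intro v hv hvi hvj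
  obtain ⟨q, r, rfl⟩ := SimpleGraph.Walk.mem_support_iff_exists_append.mp hv
  rw [SimpleGraph.Walk.length_append] at hlen
  have hq : 0 < q.length := by
    rcases Nat.eq_zero_or_pos q.length with h | h
    · exact absurd (SimpleGraph.Walk.eq_of_length_eq_zero h).symm hvi
    · exact h
  have hr : 0 < r.length := by
    rcases Nat.eq_zero_or_pos r.length with h | h
    · exact absurd (SimpleGraph.Walk.eq_of_length_eq_zero h) hvj
    · exact h
  have h1 := SimpleGraph.dist_le q
  have h2 := SimpleGraph.dist_le r
  rcases lt_trichotomy (G.degree v) k with h | h | h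
  · have := hmin i v hi h
    omega
  · exact h
  · have := hmin v j h hj
    omega
end
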